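/- Fix a real number ε with 0 < ε < 2 and a natural number k, and define f_k(s) = π^{1/2 − sε} · Γ(sε/2) / Γ((1 − sε)/2) · Γ(s) / Γ(s + k + 1) · ζ(sε). Then the function t ↦ f_k(1/2 + it) on ℝ tends to 0 as t → +∞ and as t → −∞. -/

import Mathlib

open Complex Filter

/-- The Nørlund–Rice integrand after applying the functional equation,
`f_k(s) = π^{1/2 − sε} · Γ(sε/2)/Γ((1−sε)/2) · Γ(s)/Γ(s+k+1) · ζ(sε)`. -/
noncomputable def norlundRiceIntegrand (ε : ℝ) (k : ℕ) (s : ℂ) : ℂ :=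
  (Real.pi : ℂ) ^ ((1 : ℂ) / 2 - s * (ε : ℂ)) *
      Complex.Gamma (s * (ε : ℂ) / 2) / Complex.Gamma ((1 - s * (ε : ℂ)) / 2) *
      Complex.Gamma s / Complex.Gamma (s + (k : ℂ) + 1) * riemannZeta (s * (ε : ℂ))

open Topology MeasureTheory Asymptotics

/-- The fractional part, cut off to `(1, ∞)`. -/
noncomputable def fractIoiOne : ℝ → ℂ :=
  (Set.Ioi (1 : ℝ)).indicator fun x => ((Int.fract x : ℝ) : ℂ)

lemma measurable_fractIoiOne : Measurable fractIoiOne :=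
  (Complex.measurable_ofReal.comp measurable_fract).indicator measurableSet_Ioi

lemma norm_fractIoiOne_le (x : ℝ) : ‖fractIoiOne x‖ ≤ 1 := by
  refine (norm_indicator_le_norm_self _ _).trans ?_
  rw [Complex.norm_real, Real.norm_of_nonneg (Int.fract_nonneg x)]
  exact (Int.fract_lt_one x).le

lemma locallyIntegrableOn_fractIoiOne : LocallyIntegrableOn fractIoiOne (Set.Ioi 0) := by
  refine LocallyIntegrable.locallyIntegrableOn ?_ _
  refine (locallyIntegrable_const (1 : ℝ)).mono
    measurable_fractIoiOne.aestronglyMeasurable (ae_of_all _ fun x => ?_)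
  simpa using norm_fractIoiOne_le x

lemma fractIoiOne_isBigO_atTop : fractIoiOne =O[atTop] fun x : ℝ => x ^ (-(0 : ℝ)) :=
  IsBigO.of_bound 1 (Eventually.of_forall fun x => by simpa using norm_fractIoiOne_le x)

lemma fractIoiOne_isBigO_nhdsGT_zero (b : ℝ) :
    fractIoiOne =O[𝓝[>] 0] fun x : ℝ => x ^ (-b) := by
  have h : fractIoiOne =ᶠ[𝓝[>] 0] fun _ => (0 : ℂ) := by
    filter_upwards [nhdsWithin_le_nhds (Iio_mem_nhds zero_lt_one)] with x hx
    exact Set.indicator_of_notMem (by simpa using le_of_lt hx) _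
  exact h.trans_isBigO (isBigO_zero _ _)

lemma mellinConvergent_fractIoiOne {s : ℂ} (hs : s.re < 0) : MellinConvergent fractIoiOne s :=
  mellinConvergent_of_isBigO_rpow locallyIntegrableOn_fractIoiOne fractIoiOne_isBigO_atTop hs
    (fractIoiOne_isBigO_nhdsGT_zero (s.re - 1)) (by linarith)

lemma differentiableAt_mellin_fractIoiOne {s : ℂ} (hs : s.re < 0) :
    DifferentiableAt ℂ (mellin fractIoiOne) s :=
  mellin_differentiableAt_of_isBigO_rpow locallyIntegrableOn_fractIoiOne
    fractIoiOne_isBigO_atTop hs (fractIoiOne_isBigO_nhdsGT_zero (s.re - 1)) (by linarith)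

lemma mellin_fractIoiOne (s : ℂ) :
    mellin fractIoiOne s = ∫ x in Set.Ioi (1 : ℝ), (x : ℂ) ^ (s - 1) * (Int.fract x : ℝ) := by
  have h : (fun x : ℝ => (x : ℂ) ^ (s - 1) • fractIoiOne x) =
      (Set.Ioi (1 : ℝ)).indicator fun x => (x : ℂ) ^ (s - 1) * (Int.fract x : ℝ) := by
    ext x
    by_cases hx : x ∈ Set.Ioi (1 : ℝ) <;> simp [fractIoiOne, hx]
  rw [mellin, h, setIntegral_indicator measurableSet_Ioi,
    Set.inter_eq_right.mpr (Set.Ioi_subset_Ioi zero_le_one)]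

/-- The Riemann–Lebesgue lemma for Mellin transforms along vertical lines. -/
lemma tendsto_mellin_vertical (f : ℝ → ℂ) (σ : ℝ) :
    Tendsto (fun t : ℝ => mellin f (σ + t * I)) (cocompact ℝ) (𝓝 0) := by
  have h := Real.zero_at_infty_fourier
    (fun u : ℝ => (Real.exp (-σ * u) • f (Real.exp (-u))))
  have hc : Tendsto (fun t : ℝ => t / (2 * Real.pi)) (cocompact ℝ) (cocompact ℝ) := by
    simpa [div_eq_mul_inv] using
      (Homeomorph.mulRight₀ (2 * Real.pi)⁻¹ (by positivity)).isClosedEmbedding.tendsto_cocompact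
  refine (h.comp hc).congr fun t => ?_
  simp [mellin_eq_fourier]

lemma riemannZeta_eq_of_one_lt_re {s : ℂ} (hs : 1 < s.re) :
    riemannZeta s = s / (s - 1) - s * mellin fractIoiOne (-s) := by
  have hO : (fun n : ℕ => ∑ k ∈ Finset.Icc 1 n, ‖(1 : ℕ → ℂ) k‖) =O[atTop]
      fun n => (n : ℝ) ^ (1 : ℝ) := by
    simpa using isBigO_refl (fun n : ℕ => (n : ℝ)) atTop
  have hs1 : (-s).re < -1 := by simpa using hs
  have hi := integrableOn_Ioi_cpow_of_lt hs1 zero_lt_one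
  have hf : IntegrableOn (fun x : ℝ => (x : ℂ) ^ (-s - 1) * (Int.fract x : ℝ))
      (Set.Ioi (1 : ℝ)) := by
    refine ((mellinConvergent_fractIoiOne (s := -s) (by linarith)).mono_set
      (Set.Ioi_subset_Ioi zero_le_one)).congr_fun (fun x hx => ?_) measurableSet_Ioi
    simp [fractIoiOne, Set.indicator_of_mem hx]
  have hne : s - 1 ≠ 0 := fun h => by
    rw [sub_eq_zero.mp h] at hs; simp at hs
  have hI := integral_Ioi_cpow_of_lt hs1 zero_lt_one
  have hone : -s + 1 ≠ 0 := fun h => hne (by linear_combination -h)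
  rw [← LSeries_one_eq_riemannZeta hs, LSeries_eq_mul_integral' 1 zero_le_one hs hO,
    mellin_fractIoiOne]
  have : ∫ t in Set.Ioi (1 : ℝ), (∑ k ∈ Finset.Icc 1 ⌊t⌋₊, (1 : ℕ → ℂ) k) * (t : ℂ) ^ (-(s + 1)) =
      ∫ t in Set.Ioi (1 : ℝ), ((t : ℂ) ^ (-s) - (t : ℂ) ^ (-s - 1) * (Int.fract t : ℝ)) := by
    refine setIntegral_congr_fun measurableSet_Ioi fun t ht => ?_
    have ht0 : (0 : ℝ) < t := zero_lt_one.trans ht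
    have htc : (t : ℂ) ≠ 0 := by exact_mod_cast ht0.ne'
    have hfl : ((⌊t⌋₊ : ℕ) : ℂ) = t - (Int.fract t : ℝ) := by
      have : ((⌊t⌋₊ : ℕ) : ℝ) = t - Int.fract t := by
        rw [natCast_floor_eq_intCast_floor ht0.le, Int.self_sub_fract]
      exact_mod_cast congrArg (fun x : ℝ => (x : ℂ)) this
    have hp : (t : ℂ) ^ (-s) = t * (t : ℂ) ^ (-s - 1) := by
      rw [cpow_sub _ _ htc, cpow_one]
      field_simp
    simp only [Pi.one_apply, Finset.sum_const, Nat.card_Icc, Nat.add_sub_cancel, nsmul_eq_mul,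
      mul_one, hfl, hp, neg_add']
    ring
  rw [this, integral_sub hi hf, hI]
  simp only [ofReal_one, one_cpow]
  field_simp
  ring

/-- The integral representation of `ζ` to the right of the imaginary axis. -/
lemma riemannZeta_eq_sub_mellin_fract {s : ℂ} (hs : 0 < s.re) (hs1 : s ≠ 1) :
    riemannZeta s = s / (s - 1) - s * mellin fractIoiOne (-s) := by
  let F : ℂ → ℂ := fun s => s - s * (s - 1) * mellin fractIoiOne (-s)
  let H : ℂ → ℂ := fun s =>
    ((s - 1) * completedRiemannZeta₀ s - (s - 1) / s + 1) * (Gammaℝ s)⁻¹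
  have hU : IsOpen {z : ℂ | 0 < z.re} := isOpen_lt continuous_const continuous_re
  have hH {z : ℂ} (hz : 0 < z.re) (hz1 : z ≠ 1) : H z = (z - 1) * riemannZeta z := by
    have hz0 : z ≠ 0 := ne_zero_of_re_pos hz
    have : 1 - z ≠ 0 := sub_ne_zero.mpr hz1.symm
    have : z - 1 ≠ 0 := sub_ne_zero.mpr hz1
    have hG := Gammaℝ_ne_zero_of_re_pos hz
    simp only [H]
    rw [riemannZeta_def_of_ne_zero hz0, completedRiemannZeta_eq]
    field_simp
    ring
  have hFa : AnalyticOnNhd ℂ F {z : ℂ | 0 < z.re} := by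
    refine DifferentiableOn.analyticOnNhd (fun z hz => ?_) hU
    have hz' : (-z).re < 0 := by simpa using hz
    have hm : DifferentiableAt ℂ (fun z => mellin fractIoiOne (-z)) z :=
      (differentiableAt_mellin_fractIoiOne hz').comp z differentiableAt_id.neg
    exact (DifferentiableAt.sub (by fun_prop) (DifferentiableAt.mul (by fun_prop) hm)
      ).differentiableWithinAt
  have hHa : AnalyticOnNhd ℂ H {z : ℂ | 0 < z.re} := by
    refine DifferentiableOn.analyticOnNhd (fun z hz => ?_) hU
    have hz0 : z ≠ 0 := ne_zero_of_re_pos hz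
    have h0 := differentiable_completedZeta₀ z
    have hg := differentiable_Gammaℝ_inv z
    have hd : DifferentiableAt ℂ (fun z : ℂ => (z - 1) / z) z := by fun_prop (disch := exact hz0)
    have hm : DifferentiableAt ℂ (fun z : ℂ => (z - 1) * completedRiemannZeta₀ z) z :=
      DifferentiableAt.mul (by fun_prop) h0
    exact (((hm.sub hd).add_const 1).mul hg).differentiableWithinAt
  have hev : F =ᶠ[𝓝 2] H := by
    have : {z : ℂ | 1 < z.re} ∈ 𝓝 (2 : ℂ) :=
      (isOpen_lt continuous_const continuous_re).mem_nhds (by simp)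
    filter_upwards [this] with z hz
    have hz : 1 < z.re := hz
    have hz1 : z ≠ 1 := fun h => by simp [h] at hz
    have : z - 1 ≠ 0 := sub_ne_zero.mpr hz1
    rw [hH (by linarith) hz1, riemannZeta_eq_of_one_lt_re hz]
    simp only [F]
    field_simp
  have hEq := hFa.eqOn_of_preconnected_of_eventuallyEq hHa
    (convex_halfSpace_re_gt 0).isPreconnected (show (2 : ℂ) ∈ {z : ℂ | 0 < z.re} by simp) hev hs
  rw [hH hs hs1] at hEq
  have h1 : s - 1 ≠ 0 := sub_ne_zero.mpr hs1
  refine mul_left_cancel₀ h1 (hEq.symm.trans ?_)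
  simp only [F]
  field_simp

lemma norm_Gamma_div_Gamma_add_le {s : ℂ} (hs : 0 < s.re) (k : ℕ) :
    ‖Complex.Gamma s / Complex.Gamma (s + k + 1)‖ ≤ ‖s‖⁻¹ := by
  induction k with
  | zero =>
    have hs0 : s ≠ 0 := ne_zero_of_re_pos hs
    have hG := Complex.Gamma_ne_zero_of_re_pos hs
    rw [Nat.cast_zero, add_zero, Complex.Gamma_add_one s hs0, ← norm_inv]
    apply le_of_eq
    congr 1
    field_simp
  | succ k ih =>
    have hre : 1 ≤ (s + k + 1).re := by
      simp only [add_re, natCast_re, one_re]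
      have := Nat.cast_nonneg (α := ℝ) k
      linarith
    have h1 : 1 ≤ ‖s + k + 1‖ := hre.trans (re_le_norm _)
    have h0 : s + k + 1 ≠ 0 := ne_zero_of_re_pos (zero_lt_one.trans_le hre)
    rw [Nat.cast_succ, ← add_assoc, Complex.Gamma_add_one _ h0, mul_comm, ← div_div, norm_div]
    exact (div_le_self (norm_nonneg _) h1).trans ih

/-- The functional equation in asymmetric form. -/
lemma pi_cpow_mul_Gamma_div_Gamma_mul_riemannZeta {z : ℂ} (hz : 0 < z.re) (hz1 : z ≠ 1) :
    (Real.pi : ℂ) ^ ((1 : ℂ) / 2 - z) * Complex.Gamma (z / 2) / Complex.Gamma ((1 - z) / 2) *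
      riemannZeta z = riemannZeta (1 - z) := by
  have hz0 : z ≠ 0 := ne_zero_of_re_pos hz
  have hπ : (Real.pi : ℂ) ≠ 0 := by exact_mod_cast Real.pi_ne_zero
  have hG := Complex.Gamma_ne_zero_of_re_pos (s := z / 2) (by simpa using hz)
  rw [riemannZeta_def_of_ne_zero hz0, riemannZeta_def_of_ne_zero (sub_ne_zero.mpr hz1.symm),
    completedRiemannZeta_one_sub, Gammaℝ_def, Gammaℝ_def]
  have hp : (Real.pi : ℂ) ^ ((1 : ℂ) / 2 - z) * (Real.pi : ℂ) ^ (-(1 - z) / 2) =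
      (Real.pi : ℂ) ^ (-z / 2) := by
    rw [← cpow_add _ _ hπ]; congr 1; ring
  have h1 : (Real.pi : ℂ) ^ ((1 : ℂ) / 2 - z) ≠ 0 := by simp [cpow_eq_zero_iff, hπ]
  have h2 : (Real.pi : ℂ) ^ (-(1 - z) / 2) ≠ 0 := by simp [cpow_eq_zero_iff, hπ]
  rw [← hp]
  field_simp

lemma norlundRiceIntegrand_eq {ε : ℝ} (k : ℕ) {s : ℂ} (hs : 0 < (s * ε).re) (hs1 : s * ε ≠ 1) :
    norlundRiceIntegrand ε k s =
      riemannZeta (1 - s * ε) * (Complex.Gamma s / Complex.Gamma (s + k + 1)) := by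
  rw [← pi_cpow_mul_Gamma_div_Gamma_mul_riemannZeta hs hs1, norlundRiceIntegrand]
  ring

lemma tendsto_norlundRiceIntegrand_cocompact {ε : ℝ} (hε0 : 0 < ε) (hε2 : ε < 2) (k : ℕ) :
    Tendsto (fun t : ℝ => norlundRiceIntegrand ε k (1 / 2 + (t : ℂ) * I))
      (cocompact ℝ) (𝓝 0) := by
  have hεc : (ε : ℂ) ≠ 0 := by exact_mod_cast hε0.ne'
  have hre (t : ℝ) : (1 / 2 + (t : ℂ) * I).re = 1 / 2 := by simp
  have hs0 (t : ℝ) : 1 / 2 + (t : ℂ) * I ≠ 0 := ne_zero_of_re_pos (by rw [hre]; norm_num)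
  have hinv : Tendsto (fun t : ℝ => (1 / 2 + (t : ℂ) * I)⁻¹) (cocompact ℝ) (𝓝 0) := by
    refine tendsto_inv₀_cobounded.comp (tendsto_norm_atTop_iff_cobounded.mp ?_)
    refine tendsto_atTop_mono (fun t => ?_) (tendsto_norm_cocompact_atTop (E := ℝ))
    simpa using abs_im_le_norm (1 / 2 + (t : ℂ) * I)
  have hM : Tendsto (fun t : ℝ => mellin fractIoiOne (-(1 - (1 / 2 + (t : ℂ) * I) * ε)))
      (cocompact ℝ) (𝓝 0) := by
    have hc : Tendsto (fun t : ℝ => t * ε) (cocompact ℝ) (cocompact ℝ) :=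
      (Homeomorph.mulRight₀ ε hε0.ne').isClosedEmbedding.tendsto_cocompact
    refine ((tendsto_mellin_vertical fractIoiOne (ε / 2 - 1)).comp hc).congr fun t => ?_
    simp only [Function.comp_apply]
    push_cast
    congr 1
    ring
  have hlim : Tendsto (fun t : ℝ => (ε : ℂ)⁻¹ * (ε - (1 / 2 + (t : ℂ) * I)⁻¹) *
        (1 / 2 + (t : ℂ) * I)⁻¹ - ((1 / 2 + (t : ℂ) * I)⁻¹ - ε) *
        mellin fractIoiOne (-(1 - (1 / 2 + (t : ℂ) * I) * ε))) (cocompact ℝ) (𝓝 0) := by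
    simpa using (((hinv.const_sub (ε : ℂ)).const_mul (ε : ℂ)⁻¹).mul hinv).sub
      ((hinv.sub_const (ε : ℂ)).mul hM)
  refine squeeze_zero_norm (fun t => ?_) (tendsto_zero_iff_norm_tendsto_zero.mp hlim)
  have hs := hs0 t
  have hrs := hre t
  generalize 1 / 2 + (t : ℂ) * I = s at hs hrs ⊢
  have hre1 : (s * ε).re = ε / 2 := by rw [re_mul_ofReal, hrs]; ring
  have hne1 : s * ε ≠ 1 := fun h => by
    rw [h, one_re] at hre1; linarith
  have hw : 1 - s * (ε : ℂ) ≠ 1 := by simp [hs, hεc]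
  rw [norlundRiceIntegrand_eq k (by rw [hre1]; positivity) hne1, norm_mul]
  refine (mul_le_mul_of_nonneg_left (norm_Gamma_div_Gamma_add_le (by rw [hrs]; norm_num) k)
    (norm_nonneg _)).trans (le_of_eq ?_)
  rw [← norm_inv, ← norm_mul, riemannZeta_eq_sub_mellin_fract
    (by rw [sub_re, one_re, hre1]; linarith) hw]
  congr 1
  generalize mellin fractIoiOne (-(1 - s * (ε : ℂ))) = M
  rw [show 1 - s * (ε : ℂ) - 1 = -(s * ε) by ring]
  field_simp
  ring

/-- For `0 < ε < 2` and `k : ℕ`, the integrand `f_k` evaluated on the vertical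
line `Re(s) = 1/2` tends to `0` as the imaginary part tends to `+∞` and to `−∞`. -/
theorem norlundRiceIntegrand_tendsto_zero_on_critical_line (ε : ℝ) (hε0 : 0 < ε)
    (hε2 : ε < 2) (k : ℕ) :
    Tendsto (fun t : ℝ => norlundRiceIntegrand ε k (1 / 2 + (t : ℂ) * I))
        Filter.atTop (nhds 0) ∧
      Tendsto (fun t : ℝ => norlundRiceIntegrand ε k (1 / 2 + (t : ℂ) * I))
        Filter.atBot (nhds 0) := by
  have h := tendsto_norlundRiceIntegrand_cocompact hε0 hε2 k
  rw [cocompact_eq_atBot_atTop, tendsto_sup] at h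
  exact h.symm
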